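/- arXiv:2506.13376 — 5 statements merged into one kernel-verified Lean document; each statement's English description precedes it below -/
import Mathlib

section
/- For an integer ℓ: the inequalities −2c ≤ ω + ℓ·x₄ ≤ 2c hold in L if and only if 1 ≤ ℓ ≤ p + 1; and the inequalities −2c ≤ −ω + ℓ·x₄ ≤ 2c hold if and only if −(p+1) ≤ ℓ ≤ −1. -/
noncomputable section

/-- The defining relations `2x₁ - c, 2x₂ - c, 2x₃ - c, p·x₄ - c` inside the free abelian
group on five generators `x₁, x₂, x₃, x₄, c` (realized as `Fin 5 → ℤ`). -/
def rels (p : ℤ) : Set (Fin 5 → ℤ) :=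
  { (2 : ℤ) • (Pi.single 0 1 : Fin 5 → ℤ) - Pi.single 4 1,
    (2 : ℤ) • (Pi.single 1 1 : Fin 5 → ℤ) - Pi.single 4 1,
    (2 : ℤ) • (Pi.single 2 1 : Fin 5 → ℤ) - Pi.single 4 1,
    p • (Pi.single 3 1 : Fin 5 → ℤ) - Pi.single 4 1 }

/-- The Geigle-Lenzing group `L` of type `(2,2,2,p)`: the free abelian group on
`x₁, x₂, x₃, x₄, c` modulo the subgroup generated by the relations. -/
abbrev Lgrp (p : ℤ) := (Fin 5 → ℤ) ⧸ AddSubgroup.closure (rels p)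

/-- The images of the five generators in `L`; indices `0,1,2,3` give `x₁,x₂,x₃,x₄`, and
index `4` gives the canonical element `c`. -/
def gen (p : ℤ) (i : Fin 5) : Lgrp p := QuotientAddGroup.mk (Pi.single i 1)

/-- The canonical element `c` of `L`. -/
def cel (p : ℤ) : Lgrp p := gen p 4

/-- The dualizing element `ω = c − x₁ − x₂ − x₃ − x₄`. -/
def omg (p : ℤ) : Lgrp p := cel p - gen p 0 - gen p 1 - gen p 2 - gen p 3

/-- The submonoid `L₊` of `L` generated by `x₁, x₂, x₃, x₄, c`. -/
def Lplus (p : ℤ) : AddSubmonoid (Lgrp p) := AddSubmonoid.closure (Set.range (gen p))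

/-- The partial order on `L`: `x ≤ y` iff `y − x ∈ L₊`. -/
def Lle (p : ℤ) (x y : Lgrp p) : Prop := y - x ∈ Lplus p

/-- The set `G = {0, x₁ − x₂, x₁ − x₃, x₂ − x₃} ⊆ L`. -/
def Gset (p : ℤ) : Set (Lgrp p) :=
  {0, gen p 0 - gen p 1, gen p 0 - gen p 2, gen p 1 - gen p 2}

theorem rels_closure_form (p : ℤ) (v : Fin 5 → ℤ) (hv : v ∈ AddSubgroup.closure (rels p)) :
    ∃ a b d e : ℤ, v 0 = 2 * a ∧ v 1 = 2 * b ∧ v 2 = 2 * d ∧ v 3 = p * e ∧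
      v 4 = -(a + b + d + e) := by
  induction hv using AddSubgroup.closure_induction with
  | mem x hx =>
    simp only [rels, Set.mem_insert_iff, Set.mem_singleton_iff] at hx
    rcases hx with rfl | rfl | rfl | rfl
    · exact ⟨1, 0, 0, 0, by simp [Pi.single_apply]⟩
    · exact ⟨0, 1, 0, 0, by simp [Pi.single_apply]⟩
    · exact ⟨0, 0, 1, 0, by simp [Pi.single_apply]⟩
    · exact ⟨0, 0, 0, 1, by simp [Pi.single_apply]⟩
  | zero => exact ⟨0, 0, 0, 0, by simp⟩
  | add x y _ _ hx hy =>
    obtain ⟨a, b, d, e, h0, h1, h2, h3, h4⟩ := hx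
    obtain ⟨a', b', d', e', g0, g1, g2, g3, g4⟩ := hy
    refine ⟨a + a', b + b', d + d', e + e', ?_, ?_, ?_, ?_, ?_⟩ <;>
      simp only [Pi.add_apply, *] <;> ring
  | neg x _ hx =>
    obtain ⟨a, b, d, e, h0, h1, h2, h3, h4⟩ := hx
    refine ⟨-a, -b, -d, -e, ?_, ?_, ?_, ?_, ?_⟩ <;>
      simp only [Pi.neg_apply, *] <;> ring

theorem Lplus_form (p : ℤ) (x : Lgrp p) (hx : x ∈ Lplus p) :
    ∃ v : Fin 5 → ℤ, (∀ i, 0 ≤ v i) ∧ (QuotientAddGroup.mk v : Lgrp p) = x := by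
  induction hx using AddSubmonoid.closure_induction with
  | mem x hx =>
    obtain ⟨i, rfl⟩ := hx
    refine ⟨Pi.single i 1, fun j => ?_, rfl⟩
    rw [Pi.single_apply]; split_ifs <;> simp
  | zero => exact ⟨0, by simp, rfl⟩
  | add x y _ _ hx hy =>
    obtain ⟨v, hv, rfl⟩ := hx
    obtain ⟨w, hw, rfl⟩ := hy
    exact ⟨v + w, fun i => add_nonneg (hv i) (hw i), rfl⟩

theorem key_mem (p : ℤ) (hp : 2 ≤ p) (n : ℤ) :
    gen p 0 + gen p 1 + gen p 2 + n • gen p 3 ∈ Lplus p ↔ 0 ≤ n := by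
  have hg : ∀ i, gen p i ∈ Lplus p := fun i => AddSubmonoid.subset_closure ⟨i, rfl⟩
  constructor
  · intro h
    obtain ⟨v, hv, he⟩ := Lplus_form p _ h
    have he' : (QuotientAddGroup.mk v : Lgrp p) = QuotientAddGroup.mk
      (Pi.single 0 1 + Pi.single 1 1 + Pi.single 2 1 + n • Pi.single 3 1 : Fin 5 → ℤ) := he
    rw [QuotientAddGroup.eq] at he'
    obtain ⟨a, b, d, e, h0, h1, h2, h3, h4⟩ := rels_closure_form p _ he'
    simp [Pi.single_apply] at h0 h1 h2 h3 h4
    have := hv 0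
    have := hv 1
    have := hv 2
    have := hv 3
    have := hv 4
    have he0 : 0 ≤ e := by omega
    have : 0 ≤ p * e := mul_nonneg (by omega) he0
    omega
  · intro h
    obtain ⟨m, rfl⟩ := Int.eq_ofNat_of_zero_le h
    rw [natCast_zsmul]
    exact add_mem (add_mem (add_mem (hg 0) (hg 1)) (hg 2)) (nsmul_mem (hg 3) m)

theorem rel_gen (p : ℤ) : (2 : ℤ) • gen p 0 = cel p ∧ (2 : ℤ) • gen p 1 = cel p ∧
    (2 : ℤ) • gen p 2 = cel p ∧ p • gen p 3 = cel p := by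
  have key : ∀ (n : ℤ) (i : Fin 5),
      n • (Pi.single i 1 : Fin 5 → ℤ) - Pi.single 4 1 ∈ rels p → n • gen p i = cel p := by
    intro n i h
    have h1 := (QuotientAddGroup.eq_zero_iff _).2 (AddSubgroup.subset_closure h)
    exact sub_eq_zero.1 h1
  refine ⟨key _ _ ?_, key _ _ ?_, key _ _ ?_, key _ _ ?_⟩ <;> simp [rels]

theorem low_eq (p l : ℤ) : omg p + l • gen p 3 - -((2 : ℤ) • cel p) =
    gen p 0 + gen p 1 + gen p 2 + (l - 1) • gen p 3 := by
  obtain ⟨h0, h1, h2, h3⟩ := rel_gen p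
  have : omg p + l • gen p 3 - -((2 : ℤ) • cel p) =
      cel p + cel p + cel p - gen p 0 - gen p 1 - gen p 2 + (l - 1) • gen p 3 := by
    unfold omg; module
  rw [this]
  nth_rewrite 1 [← h0]
  nth_rewrite 1 [← h1]
  rw [← h2]
  module

theorem high_eq (p l : ℤ) : (2 : ℤ) • cel p - (omg p + l • gen p 3) =
    gen p 0 + gen p 1 + gen p 2 + (p + 1 - l) • gen p 3 := by
  obtain ⟨h0, h1, h2, h3⟩ := rel_gen p
  have : (2 : ℤ) • cel p - (omg p + l • gen p 3) =
      cel p + gen p 0 + gen p 1 + gen p 2 + (1 - l) • gen p 3 := by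
    unfold omg; module
  rw [this, ← h3]
  module

/-- For `ℓ ∈ ℤ`: `−2c ≤ ω + ℓ·x₄ ≤ 2c` iff `1 ≤ ℓ ≤ p + 1`, and
`−2c ≤ −ω + ℓ·x₄ ≤ 2c` iff `−(p+1) ≤ ℓ ≤ −1`. -/
theorem stmt_6 (p : ℤ) (hp : 2 ≤ p) (l : ℤ) :
    ((Lle p (-((2 : ℤ) • cel p)) (omg p + l • gen p 3) ∧
        Lle p (omg p + l • gen p 3) ((2 : ℤ) • cel p)) ↔ (1 ≤ l ∧ l ≤ p + 1)) ∧
    ((Lle p (-((2 : ℤ) • cel p)) (-omg p + l • gen p 3) ∧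
        Lle p (-omg p + l • gen p 3) ((2 : ℤ) • cel p)) ↔ (-(p + 1) ≤ l ∧ l ≤ -1)) := by
  have e1 : -omg p + l • gen p 3 - -((2 : ℤ) • cel p) =
      (2 : ℤ) • cel p - (omg p + (-l) • gen p 3) := by module
  have e2 : (2 : ℤ) • cel p - (-omg p + l • gen p 3) =
      omg p + (-l) • gen p 3 - -((2 : ℤ) • cel p) := by module
  unfold Lle
  rw [e1, e2, low_eq, high_eq, low_eq, high_eq]
  simp only [key_mem p hp]
  omega
end
end

section
/- For indices 1 ≤ a < b ≤ 3 and an integer ℓ, the inequalities −2c ≤ (x_a − x_b) + ℓ·x₄ ≤ 2c hold in L if and only if −p ≤ ℓ ≤ p. -/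
noncomputable section

lemma aux_closure (p : ℤ) (v : Fin 5 → ℤ) (hv : v ∈ AddSubgroup.closure (rels p)) :
    2 ∣ v 0 ∧ 2 ∣ v 1 ∧ 2 ∣ v 2 ∧
      p * v 0 + p * v 1 + p * v 2 + 2 * v 3 + 2 * p * v 4 = 0 := by
  induction hv using AddSubgroup.closure_induction with
  | mem x hx =>
    simp only [rels, Set.mem_insert_iff, Set.mem_singleton_iff] at hx
    rcases hx with rfl | rfl | rfl | rfl <;> simp <;> ring
  | zero => simp
  | add x y _ _ hx hy =>
    obtain ⟨h0, h1, h2, h3⟩ := hx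
    obtain ⟨k0, k1, k2, k3⟩ := hy
    refine ⟨dvd_add h0 k0, dvd_add h1 k1, dvd_add h2 k2, ?_⟩
    simp only [Pi.add_apply]
    linear_combination h3 + k3
  | neg x _ hx =>
    obtain ⟨h0, h1, h2, h3⟩ := hx
    refine ⟨(dvd_neg).2 h0, (dvd_neg).2 h1, (dvd_neg).2 h2, ?_⟩
    simp only [Pi.neg_apply]
    linear_combination -h3

lemma aux_plus (p : ℤ) (y : Lgrp p) (hy : y ∈ Lplus p) :
    ∃ n : Fin 5 → ℤ, (∀ i, 0 ≤ n i) ∧ y = QuotientAddGroup.mk n := by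
  unfold Lplus at hy
  induction hy using AddSubmonoid.closure_induction with
  | mem x hx =>
    obtain ⟨i, rfl⟩ := hx
    refine ⟨Pi.single i 1, fun j => ?_, rfl⟩
    rw [Pi.single_apply]; split_ifs <;> norm_num
  | zero => exact ⟨0, fun _ => le_rfl, rfl⟩
  | add x y _ _ hx hy =>
    obtain ⟨n, hn, rfl⟩ := hx
    obtain ⟨m, hm, rfl⟩ := hy
    exact ⟨n + m, fun i => add_nonneg (hn i) (hm i), rfl⟩

lemma aux_rel (p : ℤ) {v : Fin 5 → ℤ} (h : v ∈ rels p) :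
    (QuotientAddGroup.mk v : Lgrp p) = 0 :=
  (QuotientAddGroup.eq_zero_iff v).2 (AddSubgroup.subset_closure h)

lemma aux_two (p : ℤ) (a : Fin 5) (ha : (a : ℕ) ≤ 2) : (2 : ℤ) • gen p a = cel p := by
  rw [← sub_eq_zero]
  refine aux_rel p (v := (2 : ℤ) • (Pi.single a 1 : Fin 5 → ℤ) - Pi.single 4 1) ?_
  have : a = 0 ∨ a = 1 ∨ a = 2 := by omega
  rcases this with rfl | rfl | rfl <;> simp [rels]

lemma aux_p (p : ℤ) : p • gen p 3 = cel p := by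
  rw [← sub_eq_zero]
  refine aux_rel p (v := p • (Pi.single 3 1 : Fin 5 → ℤ) - Pi.single 4 1) ?_
  simp [rels]

lemma aux_main (p : ℤ) (hp : 2 ≤ p) (a b : Fin 5) (hab : a < b) (hb : (b : ℕ) ≤ 2) (m : ℤ) :
    gen p a + gen p b + m • gen p 3 ∈ Lplus p ↔ 0 ≤ m := by
  have hg : ∀ i, gen p i ∈ Lplus p := fun i => AddSubmonoid.subset_closure ⟨i, rfl⟩
  constructor
  · intro h
    obtain ⟨n, hn, he⟩ := aux_plus p _ h
    have he' : (QuotientAddGroup.mk (Pi.single a 1 + Pi.single b 1 + m • Pi.single 3 1) : Lgrp p)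
        = QuotientAddGroup.mk n := he
    obtain ⟨h0, h1, h2, h3⟩ := aux_closure p _ (QuotientAddGroup.eq.1 he')
    have n0 := hn 0
    have n1 := hn 1
    have n2 := hn 2
    have n3 := hn 3
    have n4 := mul_nonneg (by omega : 0 ≤ p) (hn 4)
    have key : ∀ d : ℤ, 2 ≤ d → p * 2 ≤ p * d := fun d hd =>
      mul_le_mul_of_nonneg_left hd (by omega)
    have hs : 2 ≤ n 0 + n 1 + n 2 → 0 ≤ m := by
      intro hd
      have := key _ hd
      have hc : (a = 0 ∧ b = 1) ∨ (a = 0 ∧ b = 2) ∨ (a = 1 ∧ b = 2) := by omega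
      rcases hc with ⟨rfl, rfl⟩ | ⟨rfl, rfl⟩ | ⟨rfl, rfl⟩ <;>
        simp at h3 <;> nlinarith
    apply hs
    have hc : (a = 0 ∧ b = 1) ∨ (a = 0 ∧ b = 2) ∨ (a = 1 ∧ b = 2) := by omega
    rcases hc with ⟨rfl, rfl⟩ | ⟨rfl, rfl⟩ | ⟨rfl, rfl⟩ <;>
      simp at h0 h1 h2 <;> omega
  · intro h
    lift m to ℕ using h
    rw [natCast_zsmul]
    exact add_mem (add_mem (hg a) (hg b)) (nsmul_mem (hg 3) m)

/-- For indices `1 ≤ a < b ≤ 3` (here `0`-indexed: `a < b` with `b ≤ 2`, so that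
`gen p a`, `gen p b` range over `x₁, x₂, x₃`) and `ℓ ∈ ℤ`:
`−2c ≤ (x_a − x_b) + ℓ·x₄ ≤ 2c` iff `−p ≤ ℓ ≤ p`. -/
theorem stmt_7 (p : ℤ) (hp : 2 ≤ p) (a b : Fin 5) (hab : a < b) (hb : (b : ℕ) ≤ 2) (l : ℤ) :
    (Lle p (-((2 : ℤ) • cel p)) (gen p a - gen p b + l • gen p 3) ∧
        Lle p (gen p a - gen p b + l • gen p 3) ((2 : ℤ) • cel p)) ↔ (-p ≤ l ∧ l ≤ p) := by
  have h1 : gen p a - gen p b + l • gen p 3 - -((2 : ℤ) • cel p)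
      = gen p a + gen p b + (l + p) • gen p 3 := by
    rw [add_zsmul, aux_p, two_zsmul]
    nth_rewrite 1 [← aux_two p b hb]
    rw [two_zsmul]; abel
  have h2 : (2 : ℤ) • cel p - (gen p a - gen p b + l • gen p 3)
      = gen p a + gen p b + (p - l) • gen p 3 := by
    rw [sub_zsmul, aux_p, two_zsmul]
    nth_rewrite 1 [← aux_two p a (by omega)]
    rw [two_zsmul]; abel
  unfold Lle
  rw [h1, h2, aux_main p hp a b hab hb, aux_main p hp a b hab hb]
  omega
end
end

section
/- Let x₀ ∈ L and let V := {x₀ + g + ℓ·ω : g ∈ G, ℓ ∈ {0,1}} ⊆ L (a (ω,1)-segment). If M ⊆ V satisfies −2c ≤ y − x ≤ 2c for all x, y ∈ M, then M has at most 4 elements. -/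
noncomputable section

theorem rels_inv (p : ℤ) (u : Fin 5 → ℤ) (hu : u ∈ AddSubgroup.closure (rels p)) :
    (2 ∣ u 0 ∧ 2 ∣ u 1 ∧ 2 ∣ u 2) ∧ p * (u 0 + u 1 + u 2) + 2 * u 3 + 2 * p * u 4 = 0 := by
  induction hu using AddSubgroup.closure_induction with
  | mem x hx =>
    simp only [rels, Set.mem_insert_iff, Set.mem_singleton_iff] at hx
    rcases hx with rfl | rfl | rfl | rfl <;> simp [Pi.single_apply] <;> ring
  | zero => simp
  | add x y _ _ hx hy =>
    obtain ⟨⟨a, b, c⟩, d⟩ := hx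
    obtain ⟨⟨a', b', c'⟩, d'⟩ := hy
    refine ⟨⟨dvd_add a a', dvd_add b b', dvd_add c c'⟩, ?_⟩
    simp only [Pi.add_apply]
    linear_combination d + d'
  | neg x _ hx =>
    obtain ⟨⟨a, b, c⟩, d⟩ := hx
    refine ⟨⟨(dvd_neg).2 a, (dvd_neg).2 b, (dvd_neg).2 c⟩, ?_⟩
    simp only [Pi.neg_apply]
    linear_combination -d

theorem Lplus_rep (p : ℤ) (z : Lgrp p) (hz : z ∈ Lplus p) :
    ∃ v : Fin 5 → ℤ, (∀ i, 0 ≤ v i) ∧ (QuotientAddGroup.mk v : Lgrp p) = z := by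
  unfold Lplus at hz
  induction hz using AddSubmonoid.closure_induction with
  | mem x hx =>
    obtain ⟨i, rfl⟩ := hx
    refine ⟨Pi.single i 1, fun j => ?_, rfl⟩
    by_cases h : j = i <;> simp [Pi.single_apply, h]
  | zero => exact ⟨0, fun _ => le_rfl, rfl⟩
  | add x y _ _ hx hy =>
    obtain ⟨v, hv, rfl⟩ := hx
    obtain ⟨w, hw, rfl⟩ := hy
    exact ⟨v + w, fun i => add_nonneg (hv i) (hw i), rfl⟩

theorem omg_not (p : ℤ) (hp : 2 ≤ p) : (2 : ℤ) • cel p + omg p ∉ Lplus p := by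
  intro h
  obtain ⟨v, hv, he⟩ := Lplus_rep p _ h
  have he' : (QuotientAddGroup.mk v : Lgrp p) =
      QuotientAddGroup.mk ((2 : ℤ) • (Pi.single 4 1 : Fin 5 → ℤ) + (Pi.single 4 1 - Pi.single 0 1
        - Pi.single 1 1 - Pi.single 2 1 - Pi.single 3 1)) := he
  rw [QuotientAddGroup.eq] at he'
  obtain ⟨⟨a, b, c⟩, d⟩ := rels_inv p _ he'
  simp [Pi.single_apply] at a b c d
  have h0 := hv 0
  have h1 := hv 1
  have h2 := hv 2
  have h3 := hv 3
  have h4 := hv 4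
  have k0 : 1 ≤ v 0 := by omega
  have k1 : 1 ≤ v 1 := by omega
  have k2 : 1 ≤ v 2 := by omega
  nlinarith [mul_nonneg (by omega : 0 ≤ p) h4,
    mul_le_mul_of_nonneg_left k0 (by omega : 0 ≤ p),
    mul_le_mul_of_nonneg_left k1 (by omega : 0 ≤ p),
    mul_le_mul_of_nonneg_left k2 (by omega : 0 ≤ p)]

/-- If `M` is a subset of a `(ω,1)`-segment `{x₀ + g + ℓ·ω : g ∈ G, ℓ ∈ {0,1}}` such that
`−2c ≤ y − x ≤ 2c` for all `x, y ∈ M`, then `M` has at most `4` elements. -/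
theorem stmt_9 (p : ℤ) (hp : 2 ≤ p) (x₀ : Lgrp p) (M : Set (Lgrp p))
    (hM : M ⊆ {z | ∃ g ∈ Gset p, ∃ l : ℤ, (l = 0 ∨ l = 1) ∧ z = x₀ + g + l • omg p})
    (hrig : ∀ x ∈ M, ∀ y ∈ M,
      Lle p (-((2 : ℤ) • cel p)) (y - x) ∧ Lle p (y - x) ((2 : ℤ) • cel p)) :
    M.Finite ∧ M.ncard ≤ 4 := by
  classical
  have hM' : ∀ z : Lgrp p, z ∈ M →
      ∃ g ∈ Gset p, ∃ l : ℤ, (l = 0 ∨ l = 1) ∧ z = x₀ + g + l • omg p := fun z h => hM h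
  choose! f hf l hl hz using hM'
  have key : ∀ x ∈ M, ∀ y ∈ M, f x = f y → l x = 0 → l y = 1 → False := by
    intro x hx y hy hfe h0 h1
    have h := (hrig x hx y hy).1
    have e : y - x = omg p := by
      rw [hz y hy, hz x hx, hfe, h0, h1, one_smul, zero_smul]
      abel
    rw [e] at h
    apply omg_not p hp
    have e2 : (2 : ℤ) • cel p + omg p = omg p - -((2 : ℤ) • cel p) := by abel
    rw [e2]
    exact h
  have hinj : Set.InjOn f M := by
    intro x hx y hy hfe
    rcases hl x hx with h0 | h0 <;> rcases hl y hy with h1 | h1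
    · rw [hz x hx, hz y hy, hfe, h0, h1]
    · exact (key x hx y hy hfe h0 h1).elim
    · exact (key y hy x hx hfe.symm h1 h0).elim
    · rw [hz x hx, hz y hy, hfe, h0, h1]
  have hG : (Gset p).Finite := by unfold Gset; exact Set.toFinite _
  have hmaps : Set.MapsTo f M (Gset p) := fun x hx => hf x hx
  refine ⟨Set.Finite.of_injOn hmaps hinj hG, ?_⟩
  have hc : (Gset p).ncard ≤ 4 := by
    unfold Gset
    refine (Set.ncard_insert_le _ _).trans (Nat.succ_le_succ ?_)
    refine (Set.ncard_insert_le _ _).trans (Nat.succ_le_succ ?_)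
    refine (Set.ncard_insert_le _ _).trans (Nat.succ_le_succ ?_)
    simp
  exact (Set.ncard_le_ncard_of_injOn f hmaps hinj hG).trans hc
end
end

section
/- Let i, j, k_i, k_j be integers with 0 ≤ i ≤ j ≤ p − 2, k_j ≤ k_i and i + k_i ≤ j + k_j. Define D := {ω + n·x₄ + g : n ∈ ℤ, j + k_j − p + 1 ≤ n ≤ k_j + p, g ∈ G} ∪ {n·x₄ + g : n ∈ ℤ, k_i − p − 1 ≤ n ≤ i + k_i, g ∈ G} ⊆ L. Then for every x ∈ L, the intersection of D with the coset x + ℤ·ω has exactly 2 or exactly 3 elements. -/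
noncomputable section

/-- Linear form on the free group. -/
def preDeg (p : ℤ) : (Fin 5 → ℤ) →+ ℤ where
  toFun f := p * f 0 + p * f 1 + p * f 2 + 2 * f 3 + 2 * p * f 4
  map_zero' := by simp
  map_add' f g := by simp only [Pi.add_apply]; ring

def prePar : (Fin 5 → ℤ) →+ ZMod 2 where
  toFun f := ((f 0 + f 1 + f 2 : ℤ) : ZMod 2)
  map_zero' := by simp
  map_add' f g := by simp only [Pi.add_apply]; push_cast; ring

def degHom (p : ℤ) : Lgrp p →+ ℤ :=
  QuotientAddGroup.lift _ (preDeg p) (by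
    rw [AddSubgroup.closure_le]
    rintro f (rfl | rfl | rfl | rfl) <;>
      simp [preDeg, Pi.single_apply, AddMonoidHom.mem_ker] <;> ring)

def parHom (p : ℤ) : Lgrp p →+ ZMod 2 :=
  QuotientAddGroup.lift _ prePar (by
    rw [AddSubgroup.closure_le]
    rintro f (rfl | rfl | rfl | rfl) <;>
      simp [prePar, Pi.single_apply, AddMonoidHom.mem_ker] <;> decide)

lemma deg_gen (p : ℤ) (a : Fin 5) : degHom p (gen p a) = preDeg p (Pi.single a 1) := rfl
lemma par_gen (p : ℤ) (a : Fin 5) : parHom p (gen p a) = prePar (Pi.single a 1) := rfl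

lemma deg_x4 (p : ℤ) : degHom p (gen p 3) = 2 := by
  simp [deg_gen, preDeg, Pi.single_apply]
lemma par_x4 (p : ℤ) : parHom p (gen p 3) = 0 := by
  simp [par_gen, prePar, Pi.single_apply]
lemma deg_omg (p : ℤ) : degHom p (omg p) = -(p + 2) := by
  simp [omg, cel, deg_gen, preDeg, Pi.single_apply]; ring
lemma par_omg (p : ℤ) : parHom p (omg p) = 1 := by
  simp [omg, cel, par_gen, prePar]
lemma deg_G (p : ℤ) {g : Lgrp p} (hg : g ∈ Gset p) : degHom p g = 0 := by
  rcases hg with rfl | rfl | rfl | rfl <;> simp [deg_gen, preDeg, Pi.single_apply]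
lemma par_G (p : ℤ) {g : Lgrp p} (hg : g ∈ Gset p) : parHom p g = 0 := by
  rcases hg with rfl | rfl | rfl | rfl <;> simp [par_gen, prePar, Pi.single_apply]

lemma rel_mem (p : ℤ) {f : Fin 5 → ℤ} (hf : f ∈ rels p) :
    (QuotientAddGroup.mk f : Lgrp p) = 0 :=
  (QuotientAddGroup.eq_zero_iff f).2 (AddSubgroup.subset_closure hf)

lemma rel0 (p : ℤ) : (2 : ℤ) • gen p 0 = gen p 4 :=
  sub_eq_zero.1 (rel_mem p (f := (2 : ℤ) • (Pi.single 0 1 : Fin 5 → ℤ) - Pi.single 4 1)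
    (by simp [rels]))
lemma rel1 (p : ℤ) : (2 : ℤ) • gen p 1 = gen p 4 :=
  sub_eq_zero.1 (rel_mem p (f := (2 : ℤ) • (Pi.single 1 1 : Fin 5 → ℤ) - Pi.single 4 1)
    (by simp [rels]))
lemma rel2 (p : ℤ) : (2 : ℤ) • gen p 2 = gen p 4 :=
  sub_eq_zero.1 (rel_mem p (f := (2 : ℤ) • (Pi.single 2 1 : Fin 5 → ℤ) - Pi.single 4 1)
    (by simp [rels]))
lemma rel3 (p : ℤ) : p • gen p 3 = gen p 4 :=
  sub_eq_zero.1 (rel_mem p (f := p • (Pi.single 3 1 : Fin 5 → ℤ) - Pi.single 4 1)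
    (by simp [rels]))

lemma abs_omg {A : Type*} [AddCommGroup A] (p : ℤ) {a b c d e : A}
    (h0 : (2 : ℤ) • a = e) (h1 : (2 : ℤ) • b = e) (h2 : (2 : ℤ) • c = e) (h3 : p • d = e) :
    (2 : ℤ) • (e - a - b - c - d) = -((p + 2) • d) := by
  simp only [smul_sub, add_smul, h0, h1, h2, h3]
  abel

lemma abs_addG {A : Type*} [AddCommGroup A] {a b c e : A}
    (h0 : (2 : ℤ) • a = e) (h1 : (2 : ℤ) • b = e) (h2 : (2 : ℤ) • c = e) {g h : A}
    (hg : g ∈ ({0, a - b, a - c, b - c} : Set A)) (hh : h ∈ ({0, a - b, a - c, b - c} : Set A)) :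
    g + h ∈ ({0, a - b, a - c, b - c} : Set A) := by
  simp only [Set.mem_insert_iff, Set.mem_singleton_iff] at hg hh ⊢
  rcases hg with rfl | rfl | rfl | rfl
  · simpa using hh
  · rcases hh with rfl | rfl | rfl | rfl
    · simp
    · left; linear_combination (norm := module) h0 - h1
    · right; right; right; linear_combination (norm := module) h0 - h1
    · right; right; left; abel
  · rcases hh with rfl | rfl | rfl | rfl
    · simp
    · right; right; right; linear_combination (norm := module) h0 - h1
    · left; linear_combination (norm := module) h0 - h2
    · right; left; linear_combination (norm := module) h1 - h2
  · rcases hh with rfl | rfl | rfl | rfl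
    · simp
    · right; right; left; abel
    · right; left; linear_combination (norm := module) h1 - h2
    · left; linear_combination (norm := module) h1 - h2

lemma abs_negG {A : Type*} [AddCommGroup A] {a b c e : A}
    (h0 : (2 : ℤ) • a = e) (h1 : (2 : ℤ) • b = e) (h2 : (2 : ℤ) • c = e) {g : A}
    (hg : g ∈ ({0, a - b, a - c, b - c} : Set A)) :
    -g ∈ ({0, a - b, a - c, b - c} : Set A) := by
  simp only [Set.mem_insert_iff, Set.mem_singleton_iff] at hg ⊢
  rcases hg with rfl | rfl | rfl | rfl
  · simp
  · right; left; linear_combination (norm := module) h1 - h0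
  · right; right; left; linear_combination (norm := module) h2 - h0
  · right; right; right; linear_combination (norm := module) h2 - h1

lemma abs_gen {A : Type*} [AddCommGroup A] {a b c d e : A} (h2 : (2 : ℤ) • b = e) :
    a = (-1 : ℤ) • d + (b - c) + (-1 : ℤ) • (e - a - b - c - d) := by
  linear_combination (norm := module) -h2

lemma two_omg (p : ℤ) : (2 : ℤ) • omg p = -((p + 2) • gen p 3) :=
  abs_omg p (rel0 p) (rel1 p) (rel2 p) (rel3 p)

lemma G_add (p : ℤ) {g h : Lgrp p} (hg : g ∈ Gset p) (hh : h ∈ Gset p) : g + h ∈ Gset p :=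
  abs_addG (rel0 p) (rel1 p) (rel2 p) hg hh

lemma G_neg (p : ℤ) {g : Lgrp p} (hg : g ∈ Gset p) : -g ∈ Gset p :=
  abs_negG (rel0 p) (rel1 p) (rel2 p) hg

lemma abs_gen2 {A : Type*} [AddCommGroup A] {a b c d e : A} (h2 : (2 : ℤ) • a = e) :
    b = (-1 : ℤ) • d + (a - c) + (-1 : ℤ) • (e - a - b - c - d) := by
  linear_combination (norm := module) -h2

lemma abs_gen3 {A : Type*} [AddCommGroup A] {a b c d e : A} (h1 : (2 : ℤ) • a = e) :
    c = (-1 : ℤ) • d + (a - b) + (-1 : ℤ) • (e - a - b - c - d) := by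
  linear_combination (norm := module) -h1

lemma abs_shift {A : Type*} [AddCommGroup A] (p n t : ℤ) {w d : A}
    (h : (2 : ℤ) • w = -((p + 2) • d)) :
    n • d + (2 * t) • w = (n - t * (p + 2)) • d := by
  linear_combination (norm := module) t • h

/-- The subgroup of elements of the normal form. -/
def Ksub (p : ℤ) : AddSubgroup (Lgrp p) where
  carrier := {x | ∃ m n : ℤ, ∃ g ∈ Gset p, x = n • gen p 3 + g + m • omg p}
  zero_mem' := ⟨0, 0, 0, by simp [Gset], by simp⟩
  add_mem' := by
    rintro _ _ ⟨m, n, g, hg, rfl⟩ ⟨m', n', g', hg', rfl⟩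
    exact ⟨m + m', n + n', g + g', G_add p hg hg', by simp only [add_zsmul]; abel⟩
  neg_mem' := by
    rintro _ ⟨m, n, g, hg, rfl⟩
    exact ⟨-m, -n, -g, G_neg p hg, by simp only [neg_zsmul]; abel⟩

lemma gen_mem (p : ℤ) (a : Fin 5) : gen p a ∈ Ksub p := by
  have h3 := rel3 p
  fin_cases a
  · refine ⟨-1, -1, gen p 1 - gen p 2, by simp [Gset], ?_⟩
    exact abs_gen (rel1 p)
  · refine ⟨-1, -1, gen p 0 - gen p 2, by simp [Gset], ?_⟩
    exact abs_gen2 (rel0 p)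
  · refine ⟨-1, -1, gen p 0 - gen p 1, by simp [Gset], ?_⟩
    exact abs_gen3 (rel0 p)
  · exact ⟨0, 1, 0, by simp [Gset], by simp⟩
  · exact ⟨0, p, 0, by simp [Gset], by simp [h3]⟩

lemma all_mem (p : ℤ) (x : Lgrp p) : x ∈ Ksub p := by
  induction x using QuotientAddGroup.induction_on with
  | H f =>
    have hf : f = ∑ a, f a • (Pi.single a 1 : Fin 5 → ℤ) := by
      ext b
      simp [Finset.sum_apply, Pi.single_apply]
    have : (QuotientAddGroup.mk f : Lgrp p) = ∑ a, f a • gen p a := by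
      conv_lhs => rw [hf]
      exact map_sum (QuotientAddGroup.mk' (AddSubgroup.closure (rels p))) _ _
    rw [this]
    exact sum_mem fun a _ => zsmul_mem (gen_mem p a) _

lemma shift (p n t : ℤ) : n • gen p 3 + (2 * t) • omg p = (n - t * (p + 2)) • gen p 3 := by
  exact abs_shift p n t (two_omg p)

/-- For `0 ≤ i ≤ j ≤ p − 2`, `k_j ≤ k_i`, `i + k_i ≤ j + k_j`, and
`D = {ω + n·x₄ + g : j+k_j−p+1 ≤ n ≤ k_j+p, g ∈ G} ∪ {n·x₄ + g : k_i−p−1 ≤ n ≤ i+k_i, g ∈ G}`,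
each coset `x + ℤ·ω` meets `D` in exactly `2` or exactly `3` elements. -/
theorem stmt_12 (p : ℤ) (hp : 2 ≤ p) (i j ki kj : ℤ)
    (hi : 0 ≤ i) (hij : i ≤ j) (hj : j ≤ p - 2) (hk1 : kj ≤ ki) (hk2 : i + ki ≤ j + kj)
    (D : Set (Lgrp p))
    (hD : D = {z | ∃ n : ℤ, j + kj - p + 1 ≤ n ∧ n ≤ kj + p ∧
                    ∃ g ∈ Gset p, z = omg p + n • gen p 3 + g}
             ∪ {z | ∃ n : ℤ, ki - p - 1 ≤ n ∧ n ≤ i + ki ∧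
                    ∃ g ∈ Gset p, z = n • gen p 3 + g})
    (x : Lgrp p) :
    (D ∩ {y | ∃ n : ℤ, y = x + n • omg p}).ncard = 2 ∨
      (D ∩ {y | ∃ n : ℤ, y = x + n • omg p}).ncard = 3 := by
  have hq : 0 < p + 2 := by omega
  obtain ⟨m0, n0, g, hg, hx⟩ := all_mem p x
  -- choose a good representative
  obtain ⟨t0, r, hr1, hr2, hr⟩ : ∃ t0 r : ℤ, j + kj - p + 1 ≤ r ∧ r ≤ j + kj + 2 ∧
      n0 = r + t0 * (p + 2) := by
    refine ⟨(n0 - (j + kj - p + 1)) / (p + 2),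
      (j + kj - p + 1) + (n0 - (j + kj - p + 1)) % (p + 2), ?_, ?_, ?_⟩
    · have := Int.emod_nonneg (n0 - (j + kj - p + 1)) hq.ne'
      omega
    · have := Int.emod_lt_of_pos (n0 - (j + kj - p + 1)) hq
      omega
    · have := Int.emod_add_mul_ediv (n0 - (j + kj - p + 1)) (p + 2)
      linarith
  set e : ℤ → Lgrp p := fun m => r • gen p 3 + g + m • omg p with he
  have hinj : Function.Injective e := by
    intro a b hab
    have := congrArg (degHom p) hab
    simp only [he, map_add, map_zsmul, deg_x4, deg_omg, deg_G p hg, smul_eq_mul] at this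
    have h2 : (a - b) * (p + 2) = 0 := by linarith
    rcases mul_eq_zero.1 h2 with h | h <;> omega
  have hxe : x = e (m0 - 2 * t0) := by
    have := shift p n0 t0
    rw [show n0 - t0 * (p + 2) = r by omega] at this
    simp only [he, hx, ← this, sub_zsmul]
    abel
  have hcoset : {y | ∃ n : ℤ, y = x + n • omg p} = Set.range e := by
    ext y
    constructor
    · rintro ⟨n, rfl⟩
      refine ⟨m0 - 2 * t0 + n, ?_⟩
      rw [hxe]; simp only [he, add_zsmul]; abel
    · rintro ⟨m, rfl⟩
      refine ⟨m - (m0 - 2 * t0), ?_⟩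
      rw [hxe]; simp only [he, sub_zsmul]; abel
  have hodd : ∀ t : ℤ, e (2 * t + 1) ∈ D ↔
      j + kj - p + 1 ≤ r - t * (p + 2) ∧ r - t * (p + 2) ≤ kj + p := by
    intro t
    rw [hD]
    constructor
    · rintro (⟨n, h1, h2, g', hg', h⟩ | ⟨n, h1, h2, g', hg', h⟩)
      · have := congrArg (degHom p) h
        simp only [he, map_add, map_zsmul, deg_x4, deg_omg, deg_G p hg, deg_G p hg',
          smul_eq_mul] at this
        have : r - t * (p + 2) = n := by linarith
        omega
      · have := congrArg (parHom p) h
        simp only [he, map_add, map_zsmul, par_x4, par_omg, par_G p hg, par_G p hg'] at this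
        exfalso
        have h2 : (2 : ZMod 2) = 0 := by decide
        simp [h2] at this
    · rintro ⟨h1, h2⟩
      refine Or.inl ⟨_, h1, h2, g, hg, ?_⟩
      rw [← shift]
      simp only [he, add_zsmul, one_zsmul]; abel
  have heven : ∀ t : ℤ, e (2 * t) ∈ D ↔
      ki - p - 1 ≤ r - t * (p + 2) ∧ r - t * (p + 2) ≤ i + ki := by
    intro t
    rw [hD]
    constructor
    · rintro (⟨n, h1, h2, g', hg', h⟩ | ⟨n, h1, h2, g', hg', h⟩)
      · have := congrArg (parHom p) h
        simp only [he, map_add, map_zsmul, par_x4, par_omg, par_G p hg, par_G p hg'] at this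
        exfalso
        have h2 : (2 : ZMod 2) = 0 := by decide
        simp [h2] at this
      · have := congrArg (degHom p) h
        simp only [he, map_add, map_zsmul, deg_x4, deg_omg, deg_G p hg, deg_G p hg',
          smul_eq_mul] at this
        have : r - t * (p + 2) = n := by linarith
        omega
    · rintro ⟨h1, h2⟩
      refine Or.inr ⟨_, h1, h2, g, hg, ?_⟩
      rw [← shift]
      simp only [he]; abel
  have hodd' : ∀ t : ℤ, e (2 * t + 1) ∈ D ↔ t = 0 ∨ (t = -1 ∧ r ≤ kj - 2) := by
    intro t
    rw [hodd]
    rcases (by omega : t ≤ -2 ∨ t = -1 ∨ t = 0 ∨ 1 ≤ t) with h | rfl | rfl | h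
    · have : t * (p + 2) ≤ -2 * (p + 2) := by nlinarith
      omega
    · omega
    · omega
    · have : 1 * (p + 2) ≤ t * (p + 2) := by nlinarith
      omega
  have heven' : ∀ t : ℤ, e (2 * t) ∈ D ↔ (t = 0 ∧ r ≤ i + ki) ∨ (t = 1 ∧ ki + 1 ≤ r) := by
    intro t
    rw [heven]
    rcases (by omega : t ≤ -1 ∨ t = 0 ∨ t = 1 ∨ 2 ≤ t) with h | rfl | rfl | h
    · have : t * (p + 2) ≤ -1 * (p + 2) := by nlinarith
      omega
    · omega
    · omega
    · have : 2 * (p + 2) ≤ t * (p + 2) := by nlinarith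
      omega
  have hall : ∀ m : ℤ, m ∈ e ⁻¹' D ↔ m = 1 ∨ (m = -1 ∧ r ≤ kj - 2) ∨
      (m = 0 ∧ r ≤ i + ki) ∨ (m = 2 ∧ ki + 1 ≤ r) := by
    intro m
    rw [Set.mem_preimage]
    obtain ⟨t, rfl | rfl⟩ := Int.even_or_odd' m
    · rw [heven']; omega
    · rw [hodd']; omega
  have hcard : (D ∩ {y | ∃ n : ℤ, y = x + n • omg p}).ncard = (e ⁻¹' D).ncard := by
    rw [hcoset, ← Set.image_preimage_eq_inter_range, Set.ncard_image_of_injective _ hinj]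
  rw [hcard]
  have key : ∀ s : Finset ℤ, (∀ m, m ∈ e ⁻¹' D ↔ m ∈ s) → (e ⁻¹' D).ncard = s.card := by
    intro s hs
    rw [← Set.ncard_coe_finset]
    congr 1
    ext m
    simpa using hs m
  by_cases c1 : r ≤ kj - 2
  · right
    rw [key {1, -1, 0} (by intro m; rw [hall]; simp; omega)]; rfl
  by_cases c2 : r ≤ ki
  · left
    rw [key {1, 0} (by intro m; rw [hall]; simp; omega)]; rfl
  by_cases c3 : r ≤ i + ki
  · right
    rw [key {1, 0, 2} (by intro m; rw [hall]; simp; omega)]; rfl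
  · left
    rw [key {1, 2} (by intro m; rw [hall]; simp; omega)]; rfl
end
end

section
/- Let k_i, k_j be integers with k_j ≤ k_i ≤ k_j + p − 2 (the case i = 0, j = p − 2). Define H := {ω + a·x₄ + q : a ∈ ℤ, k_j − 1 ≤ a ≤ k_i, q ∈ G} ∪ {b·x₄ + q : b ∈ ℤ, k_i − p − 1 ≤ b ≤ k_j − 2, q ∈ G} ⊆ L. Let I ⊆ H be an H-upset, i.e. whenever z ∈ I, u ∈ L₊ and z + u ∈ H then z + u ∈ I, and set S_I := I ∪ {z − ω : z ∈ H, z ∉ I}. Then for all x, y ∈ S_I and every integer ℓ ≥ 1, one has y − x + ℓ·ω ≤ ω + 2c. -/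
noncomputable section

/-- Members of the torsion group: either zero or shifting positively. -/
lemma aux_G {M : Type*} [AddCommGroup M] (x1 x2 x3 c : M)
    (h1 : (2 : ℤ) • x1 = c) (h2 : (2 : ℤ) • x2 = c) (h3 : (2 : ℤ) • x3 = c)
    (P : AddSubmonoid M) (m1 : x1 ∈ P) (m2 : x2 ∈ P) (m3 : x3 ∈ P)
    (q : M) (hq : q ∈ ({0, x1 - x2, x1 - x3, x2 - x3} : Set M)) :
    q = 0 ∨ ((∃ u ∈ P, q + x1 + x2 + x3 = c + u) ∧ q + c ∈ P) := by
  rcases hq with rfl | rfl | rfl | rfl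
  · left; rfl
  · right
    refine ⟨⟨x3, m3, ?_⟩, ?_⟩
    · rw [← h1]; module
    · have : x1 - x2 + c = x1 + x2 := by rw [← h2]; module
      rw [this]; exact P.add_mem m1 m2
  · right
    refine ⟨⟨x2, m2, ?_⟩, ?_⟩
    · rw [← h1]; module
    · have : x1 - x3 + c = x1 + x3 := by rw [← h3]; module
      rw [this]; exact P.add_mem m1 m3
  · right
    refine ⟨⟨x1, m1, ?_⟩, ?_⟩
    · rw [← h2]; module
    · have : x2 - x3 + c = x2 + x3 := by rw [← h3]; module
      rw [this]; exact P.add_mem m2 m3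

lemma aux_Gsub {M : Type*} [AddCommGroup M] (x1 x2 x3 c : M)
    (h1 : (2 : ℤ) • x1 = c) (h2 : (2 : ℤ) • x2 = c) (h3 : (2 : ℤ) • x3 = c)
    (q r : M) (hq : q ∈ ({0, x1 - x2, x1 - x3, x2 - x3} : Set M))
    (hr : r ∈ ({0, x1 - x2, x1 - x3, x2 - x3} : Set M)) :
    q - r ∈ ({0, x1 - x2, x1 - x3, x2 - x3} : Set M) := by
  simp only [Set.mem_insert_iff, Set.mem_singleton_iff] at *
  rcases hq with rfl | rfl | rfl | rfl <;> rcases hr with rfl | rfl | rfl | rfl <;> grind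

lemma aux_key {M : Type*} [AddCommGroup M] (p : ℤ) (hp : 2 ≤ p) (x1 x2 x3 x4 c w : M)
    (h1 : (2 : ℤ) • x1 = c) (h2 : (2 : ℤ) • x2 = c) (h3 : (2 : ℤ) • x3 = c)
    (h4 : p • x4 = c) (hw : w = c - x1 - x2 - x3 - x4)
    (P : AddSubmonoid M) (m1 : x1 ∈ P) (m2 : x2 ∈ P) (m3 : x3 ∈ P) (m4 : x4 ∈ P)
    (t n : ℤ) (q : M) (hq : q ∈ ({0, x1 - x2, x1 - x3, x2 - x3} : Set M))
    (hc : (t = 2 ∧ 1 ≤ n ∧ (2 ≤ n ∨ q = 0)) ∨ (t = 1 ∧ 1 - p ≤ n ∧ (1 ≤ n ∨ q ≠ 0)) ∨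
      (t = 0 ∧ -p - 1 ≤ n ∧ (-p ≤ n ∨ q = 0)) ∨ (t = -1 ∧ -p - 1 ≤ n) ∨ (t = -2 ∧ -p - 1 ≤ n))
    (m : ℕ) : (t - m) • w + n • x4 + q + (2 : ℤ) • c ∈ P := by
  have mc : c ∈ P := by
    rw [← h1, two_zsmul]; exact P.add_mem m1 m1
  have hn4 : ∀ k : ℤ, 0 ≤ k → k • x4 ∈ P := by
    intro k hk
    lift k to ℕ using hk
    rw [natCast_zsmul]; exact P.nsmul_mem m4 k
  have hG := aux_G x1 x2 x3 c h1 h2 h3 P m1 m2 m3 q hq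
  have g1 : q + c ∈ P := by
    rcases hG with rfl | h
    · simpa using mc
    · exact h.2
  have g2 : q + x1 + x2 + x3 ∈ P := by
    rcases hG with rfl | ⟨⟨u, hu, h⟩, -⟩
    · simpa using P.add_mem (P.add_mem m1 m2) m3
    · rw [h]; exact P.add_mem mc hu
  have w2 : (2 : ℤ) • w = - c - (2 : ℤ) • x4 := by
    have : (2 : ℤ) • w = (2 : ℤ) • c - (2 : ℤ) • x1 - (2 : ℤ) • x2 - (2 : ℤ) • x3 - (2 : ℤ) • x4 := by
      rw [hw]; module
    rw [this, h1, h2, h3]; module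
  have base0 : t • w + n • x4 + q + (2 : ℤ) • c ∈ P := by
    rcases hc with ⟨rfl, hn, h⟩ | ⟨rfl, hn, h⟩ | ⟨rfl, hn, h⟩ | ⟨rfl, hn⟩ | ⟨rfl, hn⟩
    · rw [w2]
      rcases h with h | rfl
      · convert P.add_mem g1 (hn4 (n - 2) (by lia)) using 1; module
      · convert hn4 (n - 2 + p) (by lia) using 1
        rw [add_smul, h4]; module
    · have e : (1 : ℤ) • w + n • x4 + q + (2 : ℤ) • c
          = (q + x1 + x2 + x3) + (n - 1) • x4 := by
        rw [hw]
        have : (3 : ℤ) • c = (2 : ℤ) • x1 + (2 : ℤ) • x2 + (2 : ℤ) • x3 := by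
          rw [h1, h2, h3]; module
        linear_combination (norm := module) this
      rw [e]
      rcases h with h | h
      · exact P.add_mem g2 (hn4 _ (by lia))
      · rcases hG with h' | ⟨⟨u, hu, h'⟩, -⟩
        · exact absurd h' h
        · rw [h']
          convert P.add_mem hu (hn4 (n - 1 + p) (by lia)) using 1
          rw [add_smul _ p, h4]; module
    · rcases h with h | rfl
      · convert P.add_mem g1 (hn4 (n + p) (by lia)) using 1
        rw [add_smul, h4]; module
      · convert hn4 (n + p + p) (by lia) using 1
        rw [add_smul, add_smul, h4]; module
    · convert P.add_mem g2 (hn4 (n + 1 + p) (by lia)) using 1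
      rw [add_smul _ p, h4, hw]; module
    · convert P.add_mem (P.add_mem g1 mc) (hn4 (n + 2 + p) (by lia)) using 1
      rw [add_smul _ p, h4, neg_smul, w2]; module
  have base1 : (t - 1) • w + n • x4 + q + (2 : ℤ) • c ∈ P := by
    rcases hc with ⟨rfl, hn, h⟩ | ⟨rfl, hn, h⟩ | ⟨rfl, hn, h⟩ | ⟨rfl, hn⟩ | ⟨rfl, hn⟩
    · have e : ((2 : ℤ) - 1) • w + n • x4 + q + (2 : ℤ) • c
          = (q + x1 + x2 + x3) + (n - 1) • x4 := by
        rw [hw]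
        have : (3 : ℤ) • c = (2 : ℤ) • x1 + (2 : ℤ) • x2 + (2 : ℤ) • x3 := by
          rw [h1, h2, h3]; module
        linear_combination (norm := module) this
      rw [e]
      exact P.add_mem g2 (hn4 _ (by lia))
    · convert P.add_mem g1 (hn4 (n + p) (by lia)) using 1
      rw [add_smul _ p, h4]; module
    · convert P.add_mem g2 (hn4 (n + 1 + p) (by lia)) using 1
      rw [add_smul _ p, h4, hw]; module
    · convert P.add_mem (P.add_mem g1 mc) (hn4 (n + 2 + p) (by lia)) using 1
      have : ((-1 : ℤ) - 1) • w = -((2 : ℤ) • w) := by module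
      rw [add_smul _ p, h4, this, w2]; module
    · convert P.add_mem (P.add_mem g2 mc) (hn4 (n + 3 + p) (by lia)) using 1
      have : ((-2 : ℤ) - 1) • w = -((2 : ℤ) • w) - w := by module
      rw [add_smul _ p, h4, this, w2, hw]; module
  have step : ∀ s : ℤ, s • w + n • x4 + q + (2 : ℤ) • c ∈ P →
      (s - 2) • w + n • x4 + q + (2 : ℤ) • c ∈ P := by
    intro s hs
    convert P.add_mem hs (P.add_mem mc (hn4 2 (by lia))) using 1
    rw [sub_smul, w2]; module
  induction m using Nat.twoStepInduction with
  | zero => simpa using base0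
  | one => simpa using base1
  | more k ih _ =>
    have := step _ ih
    have e : t - ((k + 2 : ℕ) : ℤ) = t - k - 2 := by push_cast; ring
    rw [e]; exact this

lemma aux_main_s17 {M : Type*} [AddCommGroup M] (p : ℤ) (hp : 2 ≤ p) (x1 x2 x3 x4 c w : M)
    (h1 : (2 : ℤ) • x1 = c) (h2 : (2 : ℤ) • x2 = c) (h3 : (2 : ℤ) • x3 = c)
    (h4 : p • x4 = c) (hw : w = c - x1 - x2 - x3 - x4)
    (P : AddSubmonoid M) (m1 : x1 ∈ P) (m2 : x2 ∈ P) (m3 : x3 ∈ P) (m4 : x4 ∈ P)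
    (G : Set M) (hG : G = ({0, x1 - x2, x1 - x3, x2 - x3} : Set M))
    (ki kj : ℤ) (hk1 : kj ≤ ki) (hk2 : ki ≤ kj + p - 2) (H : Set M)
    (hH : H = {z | ∃ a : ℤ, kj - 1 ≤ a ∧ a ≤ ki ∧ ∃ q ∈ G, z = w + a • x4 + q}
             ∪ {z | ∃ b : ℤ, ki - p - 1 ≤ b ∧ b ≤ kj - 2 ∧ ∃ q ∈ G, z = b • x4 + q})
    (I : Set M) (hIH : I ⊆ H)
    (hup : ∀ z ∈ I, ∀ u ∈ P, z + u ∈ H → z + u ∈ I)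
    (S : Set M) (hS : S = I ∪ {v | ∃ z ∈ H, z ∉ I ∧ v = z - w})
    (x y : M) (hx : x ∈ S) (hy : y ∈ S) (l : ℤ) (hl : 1 ≤ l) :
    (w + (2 : ℤ) • c) - (y - x + l • w) ∈ P := by
  obtain ⟨m, rfl⟩ : ∃ m : ℕ, l = 1 + m := ⟨(l - 1).toNat, by lia⟩
  have hU : ∀ z ∈ I, ∀ z' ∈ H, z' ∉ I → z' - z ∉ P := by
    intro z hz z' hz' hn hP
    apply hn
    have := hup z hz _ hP (by simpa using hz')
    simpa using this
  have hn4 : ∀ k : ℤ, 0 ≤ k → k • x4 ∈ P := by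
    intro k hk
    lift k to ℕ using hk
    rw [natCast_zsmul]; exact P.nsmul_mem m4 k
  have hsub : ∀ q ∈ G, ∀ r ∈ G, q - r ∈ G := by
    subst hG
    exact fun q hq r hr => aux_Gsub x1 x2 x3 c h1 h2 h3 q r hq hr
  have key : ∀ (t n : ℤ) (q r : M), q ∈ G → r ∈ G → 
    ((t = 2 ∧ 1 ≤ n ∧ (2 ≤ n ∨ q - r = 0)) ∨ (t = 1 ∧ 1 - p ≤ n ∧ (1 ≤ n ∨ q - r ≠ 0)) ∨
      (t = 0 ∧ -p - 1 ≤ n ∧ (-p ≤ n ∨ q - r = 0)) ∨ (t = -1 ∧ -p - 1 ≤ n) ∨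
      (t = -2 ∧ -p - 1 ≤ n)) →
      (t - m) • w + n • x4 + (q - r) + (2 : ℤ) • c ∈ P := by
    intro t n q r hq hr h
    exact aux_key p hp x1 x2 x3 x4 c w h1 h2 h3 h4 hw P m1 m2 m3 m4 t n (q - r)
      (hG ▸ hsub q hq r hr) h m
  -- nonzero torsion differences give comparabilities
  have hnz : ∀ q ∈ G, ∀ r ∈ G, q - r ≠ 0 → (q - r) + x1 + x2 + x3 - c ∈ P := by
    intro q hq r hr hne
    rcases aux_G x1 x2 x3 c h1 h2 h3 P m1 m2 m3 (q - r) (hG ▸ hsub q hq r hr) with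
      h | ⟨⟨u, hu, h⟩, -⟩
    · exact absurd h hne
    · rw [h]; simpa using hu
  have c3 : (3 : ℤ) • c = (2 : ℤ) • x1 + (2 : ℤ) • x2 + (2 : ℤ) • x3 := by
    rw [h1, h2, h3]; module
  have rep : ∀ v ∈ S, ∃ (s a : ℤ) (z q : M), q ∈ G ∧ v = s • w + a • x4 + q ∧ z ∈ H ∧
      ((s = 1 ∧ kj - 1 ≤ a ∧ a ≤ ki ∧ z = w + a • x4 + q ∧ z ∈ I) ∨
       (s = 0 ∧ ki - p - 1 ≤ a ∧ a ≤ kj - 2 ∧ z = a • x4 + q ∧ z ∈ I) ∨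
       (s = 0 ∧ kj - 1 ≤ a ∧ a ≤ ki ∧ z = w + a • x4 + q ∧ z ∉ I) ∨
       (s = -1 ∧ ki - p - 1 ≤ a ∧ a ≤ kj - 2 ∧ z = a • x4 + q ∧ z ∉ I)) := by
    intro v hv
    rw [hS] at hv
    rcases hv with hv | ⟨z, hz, hzI, rfl⟩
    · have hvH := hIH hv
      have hvH' := hvH
      rw [hH] at hvH
      rcases hvH with ⟨a, ha1, ha2, q, hq, e⟩ | ⟨a, ha1, ha2, q, hq, e⟩
      · exact ⟨1, a, v, q, hq, by rw [e]; module, hvH', Or.inl ⟨rfl, ha1, ha2, e, hv⟩⟩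
      · exact ⟨0, a, v, q, hq, by rw [e]; module, hvH', Or.inr (Or.inl ⟨rfl, ha1, ha2, e, hv⟩)⟩
    · have hz' := hz
      rw [hH] at hz
      rcases hz with ⟨a, ha1, ha2, q, hq, e⟩ | ⟨a, ha1, ha2, q, hq, e⟩
      · exact ⟨0, a, z, q, hq, by rw [e]; module, hz',
          Or.inr (Or.inr (Or.inl ⟨rfl, ha1, ha2, e, hzI⟩))⟩
      · exact ⟨-1, a, z, q, hq, by rw [e]; module, hz',
          Or.inr (Or.inr (Or.inr ⟨rfl, ha1, ha2, e, hzI⟩))⟩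
  obtain ⟨s, a, z, q, hq, ex, hz, dx⟩ := rep x hx
  obtain ⟨s', b, z', r, hr, ey, hz', dy⟩ := rep y hy
  have goal_eq : (w + (2 : ℤ) • c) - (y - x + (1 + (m : ℤ)) • w)
      = (s - s' - m) • w + (a - b) • x4 + (q - r) + (2 : ℤ) • c := by
    rw [ex, ey]; module
  rw [goal_eq]
  apply key _ _ _ _ hq hr
  rcases dx with ⟨rfl, ha1, ha2, e, hI⟩ | ⟨rfl, ha1, ha2, e, hI⟩ | ⟨rfl, ha1, ha2, e, hI⟩ |
    ⟨rfl, ha1, ha2, e, hI⟩ <;>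
  rcases dy with ⟨rfl, hb1, hb2, e', hI'⟩ | ⟨rfl, hb1, hb2, e', hI'⟩ |
    ⟨rfl, hb1, hb2, e', hI'⟩ | ⟨rfl, hb1, hb2, e', hI'⟩ <;> try lia
  · -- types A and shifted A
    refine Or.inr (Or.inl ⟨by lia, by lia, ?_⟩)
    by_contra! hcon
    refine hU z hI z' hz' hI' ?_
    convert hn4 (b - a) (by lia) using 1
    rw [e, e', sub_eq_zero.mp hcon.2]; module
  · -- types A and shifted B
    refine Or.inl ⟨by lia, by lia, ?_⟩
    by_contra! hcon
    obtain rfl : a = b + 1 := by lia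
    refine hU z hI z' hz' hI' ?_
    have hne : r - q ≠ 0 := fun h => hcon.2 (by rw [← neg_sub, h, neg_zero])
    convert hnz r hr q hq hne using 1
    rw [e, e', hw]; module
  · -- types B and shifted A
    refine Or.inr (Or.inr (Or.inl ⟨by lia, by lia, ?_⟩))
    by_contra! hcon
    obtain rfl : b = a + 1 + p := by lia
    refine hU z hI z' hz' hI' ?_
    have hne : r - q ≠ 0 := fun h => hcon.2 (by rw [← neg_sub, h, neg_zero])
    convert hnz r hr q hq hne using 1
    rw [e, e', hw, add_smul _ p, h4]
    linear_combination (norm := module) c3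
  · -- types B and shifted B
    refine Or.inr (Or.inl ⟨by lia, by lia, ?_⟩)
    by_contra! hcon
    refine hU z hI z' hz' hI' ?_
    convert hn4 (b - a) (by lia) using 1
    rw [e, e', sub_eq_zero.mp hcon.2]; module

lemma aux_rel_s17 (p : ℤ) (n : ℤ) (i : Fin 5)
    (h : n • (Pi.single i 1 : Fin 5 → ℤ) - Pi.single 4 1 ∈ rels p) :
    n • gen p i = cel p := by
  have h2 := (QuotientAddGroup.eq_zero_iff (N := AddSubgroup.closure (rels p)) _).mpr
    (AddSubgroup.subset_closure h)
  exact sub_eq_zero.mp h2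

/-- In the case `i = 0`, `j = p − 2`: for `S_I` built from an `H`-upset `I`,
any `x, y ∈ S_I` and any integer `ℓ ≥ 1` satisfy `y − x + ℓ·ω ≤ ω + 2c`. -/
theorem stmt_17 (p : ℤ) (hp : 2 ≤ p) (ki kj : ℤ) (hk1 : kj ≤ ki) (hk2 : ki ≤ kj + p - 2)
    (H : Set (Lgrp p))
    (hH : H = {z | ∃ a : ℤ, kj - 1 ≤ a ∧ a ≤ ki ∧
                    ∃ q ∈ Gset p, z = omg p + a • gen p 3 + q}
             ∪ {z | ∃ b : ℤ, ki - p - 1 ≤ b ∧ b ≤ kj - 2 ∧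
                    ∃ q ∈ Gset p, z = b • gen p 3 + q})
    (I : Set (Lgrp p)) (hIH : I ⊆ H)
    (hup : ∀ z ∈ I, ∀ u ∈ Lplus p, z + u ∈ H → z + u ∈ I)
    (S : Set (Lgrp p))
    (hS : S = I ∪ {w | ∃ z ∈ H, z ∉ I ∧ w = z - omg p})
    (x y : Lgrp p) (hx : x ∈ S) (hy : y ∈ S) (l : ℤ) (hl : 1 ≤ l) :
    Lle p (y - x + l • omg p) (omg p + (2 : ℤ) • cel p) := by
  have hmem : ∀ i, gen p i ∈ Lplus p := fun i => AddSubmonoid.subset_closure ⟨i, rfl⟩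
  exact aux_main_s17 p hp (gen p 0) (gen p 1) (gen p 2) (gen p 3) (cel p) (omg p)
    (aux_rel_s17 p 2 0 (by simp [rels])) (aux_rel_s17 p 2 1 (by simp [rels]))
    (aux_rel_s17 p 2 2 (by simp [rels])) (aux_rel_s17 p p 3 (by simp [rels])) rfl
    (Lplus p) (hmem 0) (hmem 1) (hmem 2) (hmem 3) (Gset p) rfl ki kj hk1 hk2 H hH I hIH hup
    S hS x y hx hy l hl
end
end
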